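/- Let X and A be finite nonempty sets, P a transition kernel, π a policy, d : X → ℝ with d(x) ≥ 0 for all x, x_0 ∈ X, and d_0 ∈ ℝ. Suppose L : X → ℝ satisfies L(x) ≥ 0 for all x, T_{π,d}[L](x) ≤ L(x) for all x ∈ X, and L(x_0) ≤ d_0. Then for every integer t ≥ 0 and every state x ∈ X: (M_π^t)(x_0,x) · L(x) ≤ d_0, where M_π(x,x') = Σ_a π(a|x) P(x'|x,a) is the induced state-transition matrix and M_π^t its t-th matrix power. -/

import Mathlib

open Finset

variable {X A : Type*} [Fintype X] [Fintype A] [DecidableEq X] [Nonempty X] [Nonempty A]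

/-- A transition kernel: nonnegative, rows summing to one. -/
def IsKernel (P : X → A → X → ℝ) : Prop :=
  (∀ x a x', 0 ≤ P x a x') ∧ (∀ x a, ∑ x' : X, P x a x' = 1)

/-- A (stationary, stochastic) policy. -/
def IsPolicy (π : X → A → ℝ) : Prop :=
  (∀ x a, 0 ≤ π x a) ∧ (∀ x : X, ∑ a : A, π x a = 1)

/-- The Bellman operator `T_{π,d}[L](x) = d(x) + Σ_a π(a|x) Σ_{x'} P(x'|x,a) L(x')`. -/
noncomputable def bellmanOp (P : X → A → X → ℝ) (π : X → A → ℝ) (d : X → ℝ)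
    (L : X → ℝ) : X → ℝ :=
  fun x => d x + ∑ a : A, π x a * ∑ x' : X, P x a x' * L x'

/-- The state-transition matrix induced by a policy. -/
noncomputable def Mmat (P : X → A → X → ℝ) (π : X → A → ℝ) : Matrix X X ℝ :=
  Matrix.of fun x x' => ∑ a : A, π x a * P x a x'

/-- Lyapunov threshold bound: if `d ≥ 0`, `L ≥ 0`, `T_{π,d}[L] ≤ L` pointwise and
`L(x_0) ≤ d_0`, then `(M_π^t)(x_0,x) · L(x) ≤ d_0` for every time `t` and state `x`. -/
theorem lyapunov_threshold_bound
    (P : X → A → X → ℝ) (hP : IsKernel P)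
    (π : X → A → ℝ) (hπ : IsPolicy π)
    (d L : X → ℝ) (x0 : X) (d0 : ℝ)
    (hd : ∀ x, 0 ≤ d x) (hL0 : ∀ x, 0 ≤ L x)
    (hL : ∀ x, bellmanOp P π d L x ≤ L x)
    (hx0 : L x0 ≤ d0) :
    ∀ (t : ℕ) (x : X), (Mmat P π ^ t) x0 x * L x ≤ d0 := by
  have hM : ∀ x x', 0 ≤ Mmat P π x x' := fun x x' =>
    Finset.sum_nonneg fun a _ => mul_nonneg (hπ.1 x a) (hP.1 x a x')
  have hMt : ∀ (t : ℕ) x x', 0 ≤ (Mmat P π ^ t) x x' := by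
    intro t
    induction t with
    | zero =>
      intro x x'
      rw [pow_zero, Matrix.one_apply]
      split_ifs <;> norm_num
    | succ k ih =>
      intro x x'
      rw [pow_succ, Matrix.mul_apply]
      exact Finset.sum_nonneg fun y _ => mul_nonneg (ih x y) (hM y x')
  have hML : ∀ x, ∑ x', Mmat P π x x' * L x' ≤ L x := by
    intro x
    have h1 : ∑ x', Mmat P π x x' * L x' = ∑ a : A, π x a * ∑ x' : X, P x a x' * L x' := by
      simp only [Mmat, Matrix.of_apply, Finset.sum_mul, Finset.mul_sum]
      rw [Finset.sum_comm]
      simp only [mul_assoc]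
    have h2 := hL x
    have h3 := hd x
    simp only [bellmanOp] at h2
    linarith
  have hS : ∀ t : ℕ, ∑ x, (Mmat P π ^ t) x0 x * L x ≤ L x0 := by
    intro t
    induction t with
    | zero => simp [Matrix.one_apply]
    | succ k ih =>
      refine le_trans ?_ ih
      have h1 : ∑ x, (Mmat P π ^ (k + 1)) x0 x * L x
          = ∑ y, (Mmat P π ^ k) x0 y * ∑ x, Mmat P π y x * L x := by
        simp only [pow_succ, Matrix.mul_apply, Finset.sum_mul, Finset.mul_sum]
        rw [Finset.sum_comm]
        simp only [mul_assoc]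
      rw [h1]
      exact Finset.sum_le_sum fun y _ => mul_le_mul_of_nonneg_left (hML y) (hMt k x0 y)
  intro t x
  have h := Finset.single_le_sum (f := fun x => (Mmat P π ^ t) x0 x * L x)
    (fun y _ => mul_nonneg (hMt t x0 y) (hL0 y)) (Finset.mem_univ x)
  exact (h.trans (hS t)).trans hx0
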